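/- Let T = {a_1, a_2, ..., a_r} ⊆ [n-1] with 1 ≤ a_1 < ... < a_r < n, set a_0 = 0 and a_{r+1} = n, and define the (r+1)×(r+1) matrix θ(x) with rows and columns indexed by 0 ≤ i, j ≤ r by: θ_{ij}(x) = 0 if i > j+1; θ_{ij}(x) = 1 if i = j+1; and θ_{ij}(x) = (1-x)^{j-i}/(a_{j+1} − a_i)! if i ≤ j. Then x^r A^T_n(1/x) = n! · det(θ(x)), where x^r A^T_n(1/x) denotes the reversal Σ_{i=0}^r h_{r-i}(T) x^i of A^T_n(x) = Σ_{i=0}^r h_i(T) x^i. -/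

import Mathlib

open Polynomial

open scoped Classical

noncomputable section

/-- The descent set of a permutation `w` of `Fin n`, recorded as a subset of
`{1, ..., n-1}` (1-based positions, as in the paper: `i ∈ Des(w)` iff `w(i) > w(i+1)`). -/
def descSet {n : ℕ} (w : Equiv.Perm (Fin n)) : Finset ℕ :=
  (Finset.univ.filter (fun i : Fin (n - 1) =>
      w ⟨i.val + 1, by have := i.isLt; omega⟩ < w ⟨i.val, by have := i.isLt; omega⟩)).image
    (fun i => i.val + 1)

/-- `A^T_n(x) = Σ_{w ∈ S_n, Des(w) ⊆ T} x^{des(w)}` (note `Des(w) ⊆ {1,...,n-1}`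
automatically, so this also realizes the convention `A^T_n := A^{T ∩ [n-1]}_n`). -/
def Apoly (n : ℕ) (T : Finset ℕ) : Polynomial ℝ :=
  ∑ w ∈ Finset.univ.filter (fun w : Equiv.Perm (Fin n) => descSet w ⊆ T),
    X ^ (descSet w).card

/-- `p^T_{n,k}(x) = Σ x^{des(w)}` over permutations `w ∈ S_{n+1}` with `w(1) = k+1`
(0-based: `w 0 = k`) and `Des(w) ⊆ T`. -/
def ppoly (n k : ℕ) (T : Finset ℕ) : Polynomial ℝ :=
  ∑ w ∈ Finset.univ.filter (fun w : Equiv.Perm (Fin (n + 1)) =>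
      (w 0 : ℕ) = k ∧ descSet w ⊆ T),
    X ^ (descSet w).card

/-- A real polynomial has only real roots (or is identically zero). -/
def RealRooted (p : Polynomial ℝ) : Prop :=
  p = 0 ∨ ∀ z : ℂ, Polynomial.aeval z p = 0 → z.im = 0

/-- The list of real roots of `p`, with multiplicity, in decreasing order. -/
def rootsDesc (p : Polynomial ℝ) : List ℝ :=
  (p.roots.sort (· ≤ ·)).reverse

/-- `Interlaces p q` means `p ⪯ q`: both are real-rooted and, listing the roots of `p`
as `α_1 ≥ α_2 ≥ ⋯` and those of `q` as `β_1 ≥ β_2 ≥ ⋯`, one has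
`⋯ ≤ α_2 ≤ β_2 ≤ α_1 ≤ β_1`; by convention the zero polynomial interlaces and is
interlaced by every real-rooted polynomial. -/
def Interlaces (p q : Polynomial ℝ) : Prop :=
  (p = 0 ∧ RealRooted q) ∨ (q = 0 ∧ RealRooted p) ∨
  (RealRooted p ∧ RealRooted q ∧
    Multiset.card q.roots ≤ Multiset.card p.roots + 1 ∧
    Multiset.card p.roots ≤ Multiset.card q.roots ∧
    (∀ (i : ℕ) (hp : i < (rootsDesc p).length) (hq : i < (rootsDesc q).length),
      (rootsDesc p).get ⟨i, hp⟩ ≤ (rootsDesc q).get ⟨i, hq⟩) ∧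
    (∀ (i : ℕ) (hq : i + 1 < (rootsDesc q).length) (hp : i < (rootsDesc p).length),
      (rootsDesc q).get ⟨i + 1, hq⟩ ≤ (rootsDesc p).get ⟨i, hp⟩))

/-- Permutations that are increasing on the fibers of a monotone `f`, counted. -/
theorem card_sorted_mul {n : ℕ} {m : ℕ} (f : Fin n → Fin m) (hf : Monotone f) :
    (Finset.univ.filter (fun w : Equiv.Perm (Fin n) =>
      ∀ i j, i < j → f i = f j → w i < w j)).card *
      ∏ c : Fin m, (Fintype.card {i // f i = c}).factorial = n.factorial := by
  rw [← DomMulAct.stabilizer_card f, Fintype.card_subtype, ← Finset.card_product]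
  have hn : n.factorial = (Finset.univ : Finset (Equiv.Perm (Fin n))).card := by
    rw [Finset.card_univ, Fintype.card_perm, Fintype.card_fin]
  rw [hn]
  refine Finset.card_bij (fun p _ => p.1 * p.2) (fun _ _ => Finset.mem_univ _) ?_ ?_
  · rintro ⟨w, g⟩ h1 ⟨w', g'⟩ h2 h
    simp only [Finset.mem_product, Finset.mem_filter, Finset.mem_univ, true_and] at h1 h2 h
    have key : ∀ (w g : Equiv.Perm (Fin n)), (∀ i j, i < j → f i = f j → w i < w j) →
        f ∘ g = f → w = Tuple.sort (f ∘ ((w * g)⁻¹ : Equiv.Perm (Fin n))) := by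
      intro w g hw hg
      have e : f ∘ ((w * g)⁻¹ : Equiv.Perm (Fin n)) = f ∘ (w⁻¹ : Equiv.Perm (Fin n)) := by
        funext x
        have := congrFun hg (g⁻¹ (w⁻¹ x))
        simpa using this.symm
      rw [e, Tuple.eq_sort_iff]
      constructor
      · have : (f ∘ (w⁻¹ : Equiv.Perm (Fin n))) ∘ w = f := by
          funext x; simp
        rw [this]; exact hf
      · intro i j hij hh
        exact hw i j hij (by simpa using hh)
    have e1 := key w g h1.1 h1.2
    have e2 := key w' g' h2.1 h2.2
    rw [h, ← e2] at e1
    subst e1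
    simp only [mul_right_inj] at h
    rw [h]
  · intro v _
    set w := Tuple.sort (f ∘ (v⁻¹ : Equiv.Perm (Fin n))) with hw
    obtain ⟨hm, hs⟩ := Tuple.eq_sort_iff.1 hw
    have e : (f ∘ (v⁻¹ : Equiv.Perm (Fin n))) ∘ w = (f ∘ (v⁻¹ : Equiv.Perm (Fin n))) ∘ v := by
      refine Tuple.unique_monotone hm ?_
      have : (f ∘ (v⁻¹ : Equiv.Perm (Fin n))) ∘ v = f := by funext x; simp
      rw [this]; exact hf
    have e' : ∀ x, f (v⁻¹ (w x)) = f x := by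
      intro x; have := congrFun e x; simpa using this
    refine ⟨(w, w⁻¹ * v), ?_, by simp⟩
    simp only [Finset.mem_product, Finset.mem_filter, Finset.mem_univ, true_and]
    constructor
    · intro i j hij hh
      refine hs i j hij ?_
      simp only [Function.comp]
      rw [e', e', hh]
    · funext y
      have := e' (w⁻¹ (v y))
      simpa using this.symm

/-- Number of elements of `S` that are at most `i`. -/
def blk (S : Finset ℕ) (i : ℕ) : ℕ := (S.filter (fun s => s ≤ i)).card

theorem blk_mono (S : Finset ℕ) : Monotone (blk S) := by
  intro i j h
  apply Finset.card_le_card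
  intro s hs
  simp only [Finset.mem_filter] at hs ⊢
  exact ⟨hs.1, hs.2.trans h⟩

theorem blk_le (S : Finset ℕ) (i : ℕ) : blk S i ≤ S.card := Finset.card_filter_le _ _

theorem blk_eq_iff (S : Finset ℕ) {i j : ℕ} (h : i ≤ j) :
    blk S i = blk S j ↔ ∀ s ∈ S, i < s → j < s := by
  have hsub : S.filter (fun s => s ≤ i) ⊆ S.filter (fun s => s ≤ j) := by
    intro s hs
    simp only [Finset.mem_filter] at hs ⊢
    exact ⟨hs.1, hs.2.trans h⟩
  constructor
  · intro e s hs his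
    have e2 := Finset.eq_of_subset_of_card_le hsub (le_of_eq e.symm)
    by_contra hc
    have : s ∈ S.filter (fun s => s ≤ i) := by
      rw [e2]; simp only [Finset.mem_filter]; exact ⟨hs, by omega⟩
    simp only [Finset.mem_filter] at this
    omega
  · intro hh
    unfold blk
    congr 1
    apply Finset.filter_congr
    intro s hs
    have := hh s hs
    constructor <;> intro <;> omega

theorem mem_descSet {n : ℕ} (w : Equiv.Perm (Fin n)) (s : ℕ) :
    s ∈ descSet w ↔ ∃ (p : ℕ) (hp : p + 1 < n), s = p + 1 ∧
      w ⟨p + 1, hp⟩ < w ⟨p, by omega⟩ := by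
  unfold descSet
  simp only [Finset.mem_image, Finset.mem_filter, Finset.mem_univ, true_and]
  constructor
  · rintro ⟨i, h1, h2⟩
    exact ⟨i.val, by have := i.isLt; omega, h2.symm, h1⟩
  · rintro ⟨p, hp, h1, h2⟩
    exact ⟨⟨p, by omega⟩, h2, h1.symm⟩

theorem descSet_subset_iff {n : ℕ} (w : Equiv.Perm (Fin n)) (S : Finset ℕ) :
    descSet w ⊆ S ↔ ∀ i j : Fin n, i < j → blk S i = blk S j → w i < w j := by
  constructor
  · intro h
    have key : ∀ (d i : ℕ) (hd : i + d + 1 < n), blk S i = blk S (i + d + 1) →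
        w ⟨i, by omega⟩ < w ⟨i + d + 1, hd⟩ := by
      intro d
      have step : ∀ (p : ℕ) (hp : p + 1 < n), p + 1 ∉ S → w ⟨p, by omega⟩ < w ⟨p + 1, hp⟩ := by
        intro p hp hps
        by_contra hc
        have hne : w ⟨p + 1, hp⟩ ≠ w ⟨p, by omega⟩ := by
          intro e
          have := w.injective e
          simp at this
        exact hps (h ((mem_descSet w _).2 ⟨p, hp, rfl, lt_of_le_of_ne (not_lt.1 hc) hne⟩))
      induction d with
      | zero =>
        intro i hd e
        refine step i hd ?_
        intro hs
        have := (blk_eq_iff S (by omega)).1 e _ hs (by omega)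
        omega
      | succ d ih =>
        intro i hd e
        have e2 := (blk_eq_iff S (by omega)).1 e
        refine (ih i (by omega) ?_).trans (step (i + d + 1) hd ?_)
        · rw [blk_eq_iff S (by omega)]
          intro s hs his
          have := e2 s hs his
          omega
        · intro hs
          have := e2 _ hs (by omega)
          omega
    rintro ⟨i, hi⟩ ⟨j, hj⟩ hij e
    have hij' : i < j := hij
    obtain ⟨d, rfl⟩ : ∃ d, j = i + d + 1 := ⟨j - i - 1, by omega⟩
    exact key d i hj e
  · intro h s hs
    obtain ⟨p, hp, rfl, hlt⟩ := (mem_descSet w s).1 hs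
    by_contra hc
    have := h ⟨p, by omega⟩ ⟨p + 1, hp⟩ (by simp [Fin.lt_def]) (by
      rw [blk_eq_iff S (by simp)]
      intro s hs his
      simp only at his ⊢
      have : s ≠ p + 1 := by rintro rfl; exact hc hs
      omega)
    exact absurd this (not_lt.2 hlt.le)

/-- Size of block `c`. -/
def fib (S : Finset ℕ) (n c : ℕ) : ℕ := ((Finset.range n).filter (fun i => blk S i = c)).card

def Wt (S : Finset ℕ) (n : ℕ) : ℝ :=
  ∏ c ∈ Finset.range (S.card + 1), (((fib S n c).factorial : ℝ))⁻¹

theorem card_desc (n : ℕ) (S : Finset ℕ) :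
    (((Finset.univ.filter (fun w : Equiv.Perm (Fin n) => descSet w ⊆ S)).card : ℕ) : ℝ) =
      (n.factorial : ℝ) * Wt S n := by
  let f : Fin n → Fin (S.card + 1) := fun i => ⟨blk S i, Nat.lt_succ_of_le (blk_le S i)⟩
  have hf : Monotone f := fun i j h => blk_mono S h
  have h1 := card_sorted_mul f hf
  have h2 : (Finset.univ.filter (fun w : Equiv.Perm (Fin n) => descSet w ⊆ S)) =
      Finset.univ.filter (fun w : Equiv.Perm (Fin n) =>
        ∀ i j, i < j → f i = f j → w i < w j) := by
    apply Finset.filter_congr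
    intro w _
    rw [descSet_subset_iff]
    simp [f]
  have h3 : ∏ c : Fin (S.card + 1), (Fintype.card {i // f i = c}).factorial =
      ∏ c ∈ Finset.range (S.card + 1), (fib S n c).factorial := by
    rw [Finset.prod_range]
    refine Finset.prod_congr rfl fun c _ => ?_
    congr 1
    rw [Fintype.card_subtype]
    unfold fib
    refine Finset.card_bij (fun i _ => i.val) ?_ ?_ ?_
    · intro i hi
      simp only [Finset.mem_filter, Finset.mem_univ, true_and, f, Fin.ext_iff] at hi
      simp [hi]
    · intro i _ j _ h
      exact Fin.ext h
    · intro b hb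
      simp only [Finset.mem_filter, Finset.mem_range] at hb
      exact ⟨⟨b, hb.1⟩, by simp [f, Fin.ext_iff, hb.2], rfl⟩
  rw [← h2, h3] at h1
  rw [← h1]
  unfold Wt
  push_cast
  rw [Finset.prod_inv_distrib, mul_assoc, mul_inv_cancel₀, mul_one]
  exact Finset.prod_ne_zero_iff.2 fun c _ => by positivity

theorem Wt_empty (n : ℕ) : Wt ∅ n = ((n.factorial : ℝ))⁻¹ := by
  simp [Wt, fib, blk]

theorem Wt_insert (S : Finset ℕ) (m n : ℕ) (hS : ∀ s ∈ S, s < m) (hmn : m ≤ n) :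
    Wt (insert m S) n = Wt S m * (((n - m).factorial : ℝ))⁻¹ := by
  have hm : m ∉ S := fun h => lt_irrefl _ (hS m h)
  have hlt : ∀ i, i < m → blk (insert m S) i = blk S i := by
    intro i hi
    unfold blk
    rw [Finset.filter_insert, if_neg (by omega)]
  have hge : ∀ i, m ≤ i → blk (insert m S) i = S.card + 1 := by
    intro i hi
    unfold blk
    rw [Finset.filter_true_of_mem, Finset.card_insert_of_notMem hm]
    intro s hs
    rcases Finset.mem_insert.1 hs with rfl | hs
    · exact hi
    · have := hS s hs; omega
  unfold Wt
  rw [Finset.card_insert_of_notMem hm, Finset.prod_range_succ]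
  congr 1
  · refine Finset.prod_congr rfl fun c hc => ?_
    have hc' := Finset.mem_range.1 hc
    congr 3
    unfold fib
    congr 1
    ext i
    simp only [Finset.mem_filter, Finset.mem_range]
    by_cases hi : i < m
    · rw [hlt i hi]; constructor
      · rintro ⟨_, h⟩; exact ⟨hi, h⟩
      · rintro ⟨_, h⟩; exact ⟨by omega, h⟩
    · rw [hge i (by omega)]; constructor
      · rintro ⟨_, h⟩; omega
      · rintro ⟨h, _⟩; omega
  · congr 3
    unfold fib
    rw [← Nat.card_Ico]
    congr 1
    ext i
    simp only [Finset.mem_filter, Finset.mem_range, Finset.mem_Ico]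
    by_cases hi : i < m
    · rw [hlt i hi]
      have := blk_le S i
      constructor
      · rintro ⟨_, h⟩; omega
      · rintro ⟨h, _⟩; omega
    · rw [hge i (by omega)]
      constructor
      · rintro ⟨h, _⟩; omega
      · rintro ⟨_, h⟩; exact ⟨h, rfl⟩

/-- The Hessenberg matrix. -/
def Mat (r : ℕ) (a : ℕ → ℕ) : Matrix (Fin (r + 1)) (Fin (r + 1)) (Polynomial ℝ) :=
  Matrix.of fun i j : Fin (r + 1) =>
          if (j : ℕ) + 1 < (i : ℕ) then (0 : Polynomial ℝ)
          else if (i : ℕ) = (j : ℕ) + 1 then 1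
          else (1 - X) ^ ((j : ℕ) - (i : ℕ)) *
            C ((((a ((j : ℕ) + 1) - a (i : ℕ)).factorial : ℝ))⁻¹)

theorem det_Mat_succ (k : ℕ) (b : ℕ → ℕ) :
    (Mat (k + 1) b).det = C ((((b (k + 2) - b (k + 1)).factorial : ℝ))⁻¹) * (Mat k b).det +
      (X - 1) * (Mat k (Function.update b (k + 1) (b (k + 2)))).det := by
  rw [Matrix.det_succ_row _ (Fin.last (k + 1)), Fin.sum_univ_castSucc, Fin.sum_univ_castSucc]
  rw [Finset.sum_eq_zero, zero_add, add_comm]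
  · congr 1
    · have e : (Mat (k + 1) b).submatrix (Fin.last (k + 1)).succAbove
          (Fin.last (k + 1)).succAbove = Mat k b := by
        ext i j : 2
        simp [Mat, Fin.succAbove_last]
      rw [e]
      have e2 : Mat (k + 1) b (Fin.last (k + 1)) (Fin.last (k + 1)) =
          C ((((b (k + 2) - b (k + 1)).factorial : ℝ))⁻¹) := by
        simp [Mat]
      rw [e2, Even.neg_one_pow ⟨_, rfl⟩, one_mul]
    · have e2 : Mat (k + 1) b (Fin.last (k + 1)) (Fin.castSucc (Fin.last k)) = 1 := by
        simp [Mat]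
      rw [e2]
      have e : (Mat (k + 1) b).submatrix (Fin.last (k + 1)).succAbove
          (Fin.castSucc (Fin.last k)).succAbove =
          Matrix.of fun i j => (if j = Fin.last k then (1 - X : Polynomial ℝ) else 1) *
            Mat k (Function.update b (k + 1) (b (k + 2))) i j := by
        ext i j : 2
        have hi := i.isLt
        have hui : Function.update b (k + 1) (b (k + 2)) i = b i :=
          Function.update_of_ne (by omega) _ _
        rcases Fin.eq_castSucc_or_eq_last j with ⟨j', rfl⟩ | rfl
        · have hj := j'.isLt
          have huj : Function.update b (k + 1) (b (k + 2)) (j' + 1) = b (j' + 1) :=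
            Function.update_of_ne (by omega) _ _
          have hs : (Fin.castSucc (Fin.last k)).succAbove j'.castSucc =
              j'.castSucc.castSucc := by
            apply Fin.succAbove_of_castSucc_lt
            simp [Fin.lt_def]
          have hne : j'.castSucc ≠ Fin.last k := (Fin.castSucc_lt_last j').ne
          simp [Mat, Fin.succAbove_last, hs, hui, huj, hne]
        · have hs : (Fin.castSucc (Fin.last k)).succAbove (Fin.last k) = Fin.last (k + 1) := by
            rw [Fin.succAbove_of_le_castSucc _ _ le_rfl]; rfl
          simp only [Mat, Fin.succAbove_last, hs, Matrix.submatrix_apply, Matrix.of_apply,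
            Fin.val_last, Fin.val_castSucc, hui, Function.update_self, if_true]
          rw [if_neg (by omega), if_neg (by omega), if_neg (by omega), if_neg (by omega),
            show k + 1 - (i : ℕ) = (k - i) + 1 by omega, pow_succ]
          ring
      rw [e, Matrix.det_mul_row (fun j => if j = Fin.last k then (1 - X : Polynomial ℝ) else 1)]
      simp only [Finset.prod_ite_eq', Finset.mem_univ, if_true]
      have : ((-1 : Polynomial ℝ)) ^ (((Fin.last (k + 1) : Fin (k + 2)) : ℕ) +
          ((Fin.castSucc (Fin.last k) : Fin (k + 2)) : ℕ)) = -1 := by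
        apply Odd.neg_one_pow
        simp only [Fin.val_last, Fin.val_castSucc]
        exact ⟨k, by omega⟩
      rw [this]
      ring
  · intro j _
    have hj := j.isLt
    have : Mat (k + 1) b (Fin.last (k + 1)) (Fin.castSucc (Fin.castSucc j)) = 0 := by
      simp [Mat]
    rw [this]
    simp

theorem det_Mat (k : ℕ) : ∀ (b : ℕ → ℕ), b 0 = 0 → (∀ i ≤ k, b i < b (i + 1)) →
    (Mat k b).det = ∑ S ∈ ((Finset.Icc 1 k).image b).powerset,
      (X - 1) ^ (k - S.card) * C (Wt S (b (k + 1))) := by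
  induction k with
  | zero =>
    intro b h0 _
    simp [Mat, Wt_empty, h0]
  | succ k ih =>
    intro b h0 hb
    have hmono : ∀ i j, i < j → j ≤ k + 2 → b i < b j := by
      intro i j hij
      induction j with
      | zero => omega
      | succ j ihj =>
        intro hj
        rcases Nat.lt_succ_iff_lt_or_eq.1 hij with h | rfl
        · exact (ihj h (by omega)).trans (hb j (by omega))
        · exact hb i (by omega)
    have hlt : ∀ s ∈ (Finset.Icc 1 k).image b, s < b (k + 1) := by
      intro s hs
      obtain ⟨i, hi, rfl⟩ := Finset.mem_image.1 hs
      have := Finset.mem_Icc.1 hi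
      exact hmono _ _ (by omega) (by omega)
    have hni : b (k + 1) ∉ (Finset.Icc 1 k).image b := fun h => lt_irrefl _ (hlt _ h)
    have hins : (Finset.Icc 1 (k + 1)).image b =
        insert (b (k + 1)) ((Finset.Icc 1 k).image b) := by
      rw [← Finset.image_insert]
      congr 1
      ext i; simp only [Finset.mem_Icc, Finset.mem_insert]; omega
    have himg : (Finset.Icc 1 k).image (Function.update b (k + 1) (b (k + 2))) =
        (Finset.Icc 1 k).image b := by
      apply Finset.image_congr
      intro i hi
      have := Finset.mem_Icc.1 (Finset.mem_coe.1 hi)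
      exact Function.update_of_ne (by omega) _ _
    rw [det_Mat_succ, ih b h0 (fun i hi => hb i (by omega)), ih, himg, hins,
      Finset.sum_powerset_insert hni, add_comm, Finset.mul_sum, Finset.mul_sum,
      Function.update_self]
    · congr 1
      · refine Finset.sum_congr rfl fun S hS => ?_
        have hc : S.card ≤ k := by
          refine (Finset.card_le_card (Finset.mem_powerset.1 hS)).trans ?_
          exact Finset.card_image_le.trans (by simp)
        rw [show k + 1 - S.card = (k - S.card) + 1 by omega, pow_succ]
        ring
      · refine Finset.sum_congr rfl fun S hS => ?_
        have hS' := Finset.mem_powerset.1 hS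
        rw [Wt_insert S (b (k + 1)) _ (fun s hs => hlt s (hS' hs)) (hb (k + 1) le_rfl).le,
          Finset.card_insert_of_notMem (fun h => hni (hS' h)), Nat.add_sub_add_right, C_mul]
        ring
    · rw [Function.update_of_ne (by omega), h0]
    · intro i hi
      rw [Function.update_of_ne (by omega)]
      rcases Nat.lt_or_eq_of_le hi with h | rfl
      · rw [Function.update_of_ne (by omega)]; exact hb i (by omega)
      · rw [Function.update_self]; exact hmono _ _ (by omega) le_rfl

theorem X_pow_eq (T D : Finset ℕ) (h : D ⊆ T) :
    (X : Polynomial ℝ) ^ (T.card - D.card) =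
      ∑ S ∈ T.powerset.filter (fun S => D ⊆ S), (X - 1) ^ (T.card - S.card) := by
  have h1 := Finset.sum_pow_mul_eq_add_pow (X - 1 : Polynomial ℝ) 1 (T \ D)
  rw [sub_add_cancel, Finset.card_sdiff_of_subset h] at h1
  rw [← h1]
  refine Finset.sum_bij' (fun U _ => T \ U) (fun S _ => T \ S) ?_ ?_ ?_ ?_ ?_
  · intro U hU
    have := Finset.mem_powerset.1 hU
    simp only [Finset.mem_filter, Finset.mem_powerset]
    refine ⟨Finset.sdiff_subset, fun x hx => ?_⟩
    rw [Finset.mem_sdiff]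
    exact ⟨h hx, fun hxu => (Finset.mem_sdiff.1 (this hxu)).2 hx⟩
  · intro S hS
    simp only [Finset.mem_filter, Finset.mem_powerset] at hS ⊢
    exact Finset.sdiff_subset_sdiff le_rfl hS.2
  · intro U hU
    have := Finset.mem_powerset.1 hU
    exact Finset.sdiff_sdiff_eq_self (this.trans Finset.sdiff_subset)
  · intro S hS
    simp only [Finset.mem_filter, Finset.mem_powerset] at hS
    exact Finset.sdiff_sdiff_eq_self hS.1
  · intro U hU
    have := (Finset.mem_powerset.1 hU).trans Finset.sdiff_subset
    have hc := Finset.card_le_card this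
    rw [one_pow, mul_one, Finset.card_sdiff_of_subset this]
    congr 1
    omega

theorem reversal_eq (n r : ℕ) (T : Finset ℕ) (hT : T.card = r) :
    (∑ i ∈ Finset.range (r + 1), C ((Apoly n T).coeff (r - i)) * X ^ i) =
      ∑ w ∈ Finset.univ.filter (fun w : Equiv.Perm (Fin n) => descSet w ⊆ T),
        (X : Polynomial ℝ) ^ (r - (descSet w).card) := by
  unfold Apoly
  simp only [Polynomial.finsetSum_coeff, map_sum, Finset.sum_mul]
  rw [Finset.sum_comm]
  refine Finset.sum_congr rfl fun w hw => ?_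
  have hc : (descSet w).card ≤ r := by
    rw [← hT]; exact Finset.card_le_card (Finset.mem_filter.1 hw).2
  rw [Finset.sum_eq_single (r - (descSet w).card)]
  · rw [coeff_X_pow, if_pos (by omega)]; simp
  · intro i hi hne
    have := Finset.mem_range.1 hi
    rw [coeff_X_pow, if_neg (by omega)]; simp
  · intro h
    exact absurd (Finset.mem_range.2 (by omega)) h

/-- Gessel's determinantal formula: with `T = {a_1 < ⋯ < a_r} ⊆ [n-1]`,
`a_0 = 0`, `a_{r+1} = n`, and the `(r+1)×(r+1)` matrix `θ(x)` with
`θ_{ij} = 0` for `i > j+1`, `θ_{ij} = 1` for `i = j+1` and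
`θ_{ij} = (1-x)^{j-i}/(a_{j+1} - a_i)!` for `i ≤ j`, one has
`x^r A^T_n(1/x) = n! · det θ(x)`, where `x^r A^T_n(1/x) = Σ_{i=0}^r h_{r-i}(T) x^i`
is the reversal of `A^T_n(x) = Σ_{i=0}^r h_i(T) x^i`. -/
theorem stmt8 (n r : ℕ) (hn : 0 < n) (a : ℕ → ℕ) (ha0 : a 0 = 0) (han : a (r + 1) = n)
    (hinc : ∀ i ≤ r, a i < a (i + 1)) (T : Finset ℕ) (hT : T = (Finset.Icc 1 r).image a) :
    (∑ i ∈ Finset.range (r + 1), C ((Apoly n T).coeff (r - i)) * X ^ i) =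
      C ((n.factorial : ℝ)) *
        Matrix.det (Matrix.of fun i j : Fin (r + 1) =>
          if (j : ℕ) + 1 < (i : ℕ) then (0 : Polynomial ℝ)
          else if (i : ℕ) = (j : ℕ) + 1 then 1
          else (1 - X) ^ ((j : ℕ) - (i : ℕ)) *
            C ((((a ((j : ℕ) + 1) - a (i : ℕ)).factorial : ℝ))⁻¹)) := by
  have hmono : ∀ i j, i < j → j ≤ r + 1 → a i < a j := by
    intro i j hij
    induction j with
    | zero => omega
    | succ j ihj =>
      intro hj
      rcases Nat.lt_succ_iff_lt_or_eq.1 hij with h | rfl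
      · exact (ihj h (by omega)).trans (hinc j (by omega))
      · exact hinc i (by omega)
  have hcard : T.card = r := by
    rw [hT, Finset.card_image_of_injOn]
    · simp
    · intro i hi j hj e
      have hi' := Finset.mem_Icc.1 (Finset.mem_coe.1 hi)
      have hj' := Finset.mem_Icc.1 (Finset.mem_coe.1 hj)
      rcases lt_trichotomy i j with h | h | h
      · exact absurd e (hmono i j h (by omega)).ne
      · exact h
      · exact absurd e (hmono j i h (by omega)).ne'
  have hdet := det_Mat r a ha0 hinc
  rw [← hT, han] at hdet
  unfold Mat at hdet
  rw [hdet, reversal_eq n r T hcard, Finset.mul_sum]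
  have e1 : ∀ w ∈ Finset.univ.filter (fun w : Equiv.Perm (Fin n) => descSet w ⊆ T),
      (X : Polynomial ℝ) ^ (r - (descSet w).card) =
        ∑ S ∈ T.powerset.filter (fun S => descSet w ⊆ S), (X - 1) ^ (r - S.card) := by
    intro w hw
    have := X_pow_eq T (descSet w) (Finset.mem_filter.1 hw).2
    rwa [hcard] at this
  rw [Finset.sum_congr rfl e1]
  rw [Finset.sum_comm' (t' := T.powerset)
    (s' := fun S => Finset.univ.filter (fun w : Equiv.Perm (Fin n) => descSet w ⊆ S))]
  · refine Finset.sum_congr rfl fun S _ => ?_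
    rw [Finset.sum_const, nsmul_eq_mul, ← C_eq_natCast, card_desc, C_mul]
    ring
  · intro w S
    simp only [Finset.mem_filter, Finset.mem_univ, true_and, Finset.mem_powerset]
    constructor
    · rintro ⟨_, h2, h3⟩; exact ⟨h3, h2⟩
    · rintro ⟨h3, h2⟩; exact ⟨h3.trans h2, h2, h3⟩
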